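/- If the separating function F(x,λ,c) is globally parametrically exact with exact tuning parameter λ*, the set Ω is closed, and f is lower semicontinuous on Ω, then F is a penalty-type separating function for λ = λ*. -/

import Mathlib

open Set Filter Topology

/-- The set of global minimizers of `g` on the set `A`. -/
def minimizersOn {X : Type*} (g : X → EReal) (A : Set X) : Set X :=
  {x ∈ A | ∀ y ∈ A, g x ≤ g y}

/-- The set of globally optimal solutions of the problem (P):
minimize `f x` subject to `x ∈ M`, `x ∈ A`. -/
def optSet {X : Type*} (f : X → EReal) (M A : Set X) : Set X :=
  minimizersOn f (M ∩ A)

/-- `F` is globally parametrically exact with exact tuning parameter `lam`. -/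
def GloballyParamExact {X Λ : Type*} (f : X → EReal) (M A : Set X)
    (F : X → Λ → ℝ → EReal) (lam : Λ) : Prop :=
  ∃ cs > (0 : ℝ), ∀ c ≥ cs, minimizersOn (fun x => F x lam c) A = optSet f M A

/-- `F` is locally parametrically exact at `x₀` with exact tuning parameter `lam`. -/
def LocallyParamExact {X Λ : Type*} [TopologicalSpace X] (A : Set X)
    (F : X → Λ → ℝ → EReal) (lam : Λ) (x₀ : X) : Prop :=
  ∃ cs > (0 : ℝ), ∃ U ∈ 𝓝 x₀, ∀ c ≥ cs, ∀ x ∈ U ∩ A, F x₀ lam c ≤ F x lam c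

/-- `F` is a penalty-type separating function for `λ = lam`. -/
def PenaltyType {X Λ : Type*} [TopologicalSpace X] (f : X → EReal) (M A : Set X)
    (F : X → Λ → ℝ → EReal) (lam : Λ) : Prop :=
  ∃ c₀ > (0 : ℝ), ∀ cseq : ℕ → ℝ, StrictMono cseq → (∀ n, c₀ ≤ cseq n) →
    Tendsto cseq atTop atTop →
    ∀ xseq : ℕ → X, (∀ n, xseq n ∈ minimizersOn (fun x => F x lam (cseq n)) A) →
    ∀ x₀ : X, MapClusterPt x₀ atTop xseq → x₀ ∈ optSet f M A

/-- `F` is non-degenerate for `λ = lam`. -/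
def NonDegenerate {X Λ : Type*} [NormedAddCommGroup X] (A : Set X)
    (F : X → Λ → ℝ → EReal) (lam : Λ) : Prop :=
  ∃ c₀ > (0 : ℝ), ∃ R > (0 : ℝ), ∀ c ≥ c₀,
    ∃ x ∈ minimizersOn (fun y => F y lam c) A, ‖x‖ ≤ R

/-- The minimizers of a lower semicontinuous function on a closed set form a closed set. -/
theorem isClosed_minimizersOn {X : Type*} [TopologicalSpace X] {g : X → EReal} {S : Set X}
    (hS : IsClosed S) (hg : LowerSemicontinuousOn g S) : IsClosed (minimizersOn g S) := by
  refine isClosed_of_closure_subset fun x hx => ?_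
  have hxS : x ∈ S := hS.closure_subset_iff.2 (fun z hz => hz.1) hx
  refine ⟨hxS, fun y hy => ?_⟩
  by_contra! hlt
  have hev := eventually_nhdsWithin_iff.1 (hg x hxS (g y) hlt)
  obtain ⟨z, hz, hzy⟩ := ((mem_closure_iff_frequently.1 hx).and_eventually hev).exists
  exact (hzy hz.1).not_ge (hz.2 y hy)

/-- If the separating function `F` is globally parametrically exact with exact tuning
parameter `λ*`, the feasible set `Ω = M ∩ A` is closed and `f` is lower semicontinuous
on `Ω`, then `F` is a penalty-type separating function for `λ = λ*`. -/
theorem globally_exact_implies_penalty_type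
    {X : Type*} [NormedAddCommGroup X] [NormedSpace ℝ X] [FiniteDimensional ℝ X]
    {Λ : Type*} [Nonempty Λ]
    (f : X → EReal) (M A : Set X) (F : X → Λ → ℝ → EReal)
    (hM : M.Nonempty) (hA : A.Nonempty)
    (hfeas : ∃ x ∈ M ∩ A, f x < ⊤)
    (hopt : (optSet f M A).Nonempty)
    (hΩ : IsClosed (M ∩ A))
    (hf : LowerSemicontinuousOn f (M ∩ A))
    (lam : Λ) (hglob : GloballyParamExact f M A F lam) :
    PenaltyType f M A F lam := by
  obtain ⟨cs, hcs, heq⟩ := hglob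
  refine ⟨cs, hcs, fun cseq _ hge _ xseq hx x₀ hcl => ?_⟩
  have hmem : ∀ n, xseq n ∈ optSet f M A := fun n => heq (cseq n) (hge n) ▸ hx n
  exact (isClosed_minimizersOn hΩ hf).mem_of_mapClusterPt hcl (Eventually.of_forall hmem)
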